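/- Borel-type lemma with norm control: Let (c_{m,q})_{m∈ℕ, 0≤q≤m} be real numbers, and suppose there exist constants D ≥ 1 and an increasing sequence (K_m) with |c_{m,q}| ≤ D^m · K_m · C(m,q) for all m, q. Then for every M ∈ ℕ there exists h ∈ C_c^∞(ℝ²) with ∂₁^{m−q}∂₂^q h(0,0)·C(m,q) = c_{m,q} for all m, q, and with C^M-norm bounded by s_M · D^M · K_M + e^D/⌊D⌋! for an explicit constant s_M independent of D and (K_m). -/

import Mathlib

noncomputable def mixedD (p q : ℕ) (h : ℝ × ℝ → ℝ) (x : ℝ × ℝ) : ℝ :=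
  iteratedDeriv p (fun a => iteratedDeriv q (fun b => h (a, b)) x.2) x.1

lemma iteratedFDeriv_dir (n : ℕ) (h : ℝ × ℝ → ℝ) (hh : ContDiff ℝ (⊤ : ℕ∞) h) (e x : ℝ × ℝ)
    (v : Fin n → ℝ × ℝ) :
    iteratedFDeriv ℝ n (fun y => fderiv ℝ h y e) x v =
      iteratedFDeriv ℝ (n + 1) h x (Fin.snoc v e) := by
  rw [iteratedFDeriv_succ_apply_right]
  have hf : ContDiff ℝ (⊤ : ℕ∞) (fun y => fderiv ℝ h y) := hh.fderiv_right (by simp)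
  have := (ContinuousLinearMap.apply ℝ ℝ e).iteratedFDeriv_comp_left (x := x) hf.contDiffAt
    (i := n) (by exact_mod_cast le_top)
  have h2 : (fun y => fderiv ℝ h y e) = (ContinuousLinearMap.apply ℝ ℝ e) ∘ (fun y => fderiv ℝ h y) := by
    ext y; simp
  rw [h2, this]
  simp

lemma contDiff_dir (h : ℝ × ℝ → ℝ) (hh : ContDiff ℝ (⊤ : ℕ∞) h) (e : ℝ × ℝ) :
    ContDiff ℝ (⊤ : ℕ∞) (fun y => fderiv ℝ h y e) := by
  have hf : ContDiff ℝ (⊤ : ℕ∞) (fun y => fderiv ℝ h y) := hh.fderiv_right (by simp)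
  exact hf.clm_apply contDiff_const

lemma mixedD_eq (p q : ℕ) : ∃ v : Fin (p + q) → ℝ × ℝ, (∀ i, ‖v i‖ ≤ 1) ∧
    ∀ h : ℝ × ℝ → ℝ, ContDiff ℝ (⊤ : ℕ∞) h → ∀ x,
      mixedD p q h x = iteratedFDeriv ℝ (p + q) h x v := by
  induction q with
  | zero =>
    induction p with
    | zero =>
      refine ⟨fun _ => 0, by simp, fun h hh x => ?_⟩
      simp [mixedD]
    | succ p ih =>
      obtain ⟨v, hv, H⟩ := ih
      rw [show p + 1 + 0 = (p + 0) + 1 by ring]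
      refine ⟨Fin.snoc v (1, 0), ?_, fun h hh x => ?_⟩
      · intro i
        refine Fin.lastCases ?_ (fun j => ?_) i
        · simp
        · simpa using hv j
      · refine Eq.trans ?_ (iteratedFDeriv_dir (p + 0) _ hh (1, 0) x v)
        rw [← H _ (contDiff_dir h hh _)]
        simp only [mixedD, iteratedDeriv_zero]
        rw [iteratedDeriv_succ']
        congr 1
        ext a
        have h1 : HasFDerivAt h (fderiv ℝ h (a, x.2)) (a, x.2) :=
          (hh.differentiable (by simp) _).hasFDerivAt
        have h2 : HasDerivAt (fun a : ℝ => (a, x.2)) ((1 : ℝ), (0 : ℝ)) a :=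
          (hasDerivAt_id a).prodMk (hasDerivAt_const a x.2)
        exact (h1.comp_hasDerivAt a h2).deriv
  | succ q ih =>
    obtain ⟨v, hv, H⟩ := ih
    refine ⟨Fin.snoc (n := p + q) (α := fun _ => ℝ × ℝ) v (0, 1), ?_, fun h hh x => ?_⟩
    · intro i
      refine Fin.lastCases (n := p + q) ?_ (fun j => ?_) i
      · simp
      · simpa using hv j
    · have := iteratedFDeriv_dir _ _ hh (0, 1) x v
      refine Eq.trans ?_ this
      rw [← H _ (contDiff_dir h hh _)]
      simp only [mixedD]
      congr 1
      ext a
      rw [iteratedDeriv_succ']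
      congr 1
      ext b
      have h1 : HasFDerivAt h (fderiv ℝ h (a, b)) (a, b) :=
        (hh.differentiable (by simp) _).hasFDerivAt
      have h2 : HasDerivAt (fun b : ℝ => (a, b)) ((0 : ℝ), (1 : ℝ)) b :=
        (hasDerivAt_const b a).prodMk (hasDerivAt_id b)
      exact (h1.comp_hasDerivAt b h2).deriv

lemma mixedD_monomial (p r i j : ℕ) :
    mixedD p r (fun x => x.1 ^ i * x.2 ^ j) 0 =
      (if p = i then (i.factorial : ℝ) else 0) * (if r = j then (j.factorial : ℝ) else 0) := by
  simp only [mixedD]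
  have h1 : ∀ a : ℝ, iteratedDeriv r (fun b : ℝ => a ^ i * b ^ j) 0 =
      (if r = j then (j.factorial : ℝ) else 0) * a ^ i := by
    intro a
    rw [iteratedDeriv_const_mul_field, iteratedDeriv_fun_pow_zero]
    push_cast
    ring
  simp only [Prod.fst_zero, Prod.snd_zero, h1]
  rw [iteratedDeriv_const_mul_field, iteratedDeriv_fun_pow_zero]
  push_cast
  ring

lemma scale_bound (F : ℝ × ℝ → ℝ) (hF : ContDiff ℝ (⊤ : ℕ∞) F) (k i : ℕ) (C e : ℝ) (he : 0 < e)
    (hC : ∀ x, ‖iteratedFDeriv ℝ k F x‖ ≤ C) (x : ℝ × ℝ) :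
    ‖iteratedFDeriv ℝ k (fun x => e ^ i * F (e⁻¹ • x)) x‖ ≤ e ^ i * (e⁻¹) ^ k * C := by
  set g : ℝ × ℝ →L[ℝ] ℝ × ℝ := e⁻¹ • ContinuousLinearMap.id ℝ (ℝ × ℝ) with hg
  have hgn : ‖g‖ ≤ e⁻¹ := by
    rw [hg, norm_smul, Real.norm_of_nonneg (by positivity)]
    exact mul_le_of_le_one_right (by positivity) ContinuousLinearMap.norm_id_le
  have h1 : (fun x => e ^ i * F (e⁻¹ • x)) = (e ^ i) • (F ∘ g) := by
    ext y; simp [hg]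
  have hk : ((k : ℕ) : WithTop ℕ∞) ≤ ((⊤ : ℕ∞) : WithTop ℕ∞) := by exact_mod_cast le_top
  rw [h1, iteratedFDeriv_const_smul_apply ((hF.comp g.contDiff).of_le hk).contDiffAt,
    g.iteratedFDeriv_comp_right hF x hk, norm_smul, Real.norm_of_nonneg (by positivity), mul_assoc]
  gcongr
  refine (ContinuousMultilinearMap.norm_compContinuousLinearMap_le _ _).trans ?_
  rw [mul_comm]
  simp only [Finset.prod_const, Finset.card_univ, Fintype.card_fin]
  have := hC (g x)
  gcongr

noncomputable def phiB : ContDiffBump (0 : ℝ × ℝ) := ⟨1 / 2, 1, by norm_num, by norm_num⟩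

noncomputable def psiB (m q : ℕ) (x : ℝ × ℝ) : ℝ := phiB x * (x.1 ^ (m - q) * x.2 ^ q)

lemma psiB_contDiff (m q : ℕ) : ContDiff ℝ (⊤ : ℕ∞) (psiB m q) := by
  have h1 : ContDiff ℝ (⊤ : ℕ∞) (phiB : ℝ × ℝ → ℝ) := phiB.contDiff
  unfold psiB
  fun_prop

lemma psiB_compact (m q : ℕ) : HasCompactSupport (psiB m q) :=
  (phiB.hasCompactSupport).mul_right

lemma psiB_zero (m q : ℕ) (x : ℝ × ℝ) (hx : 1 ≤ ‖x‖) : psiB m q x = 0 := by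
  have : phiB x = 0 := phiB.zero_of_le_dist (by simpa [phiB] using hx)
  simp [psiB, this]

lemma psiB_one (m q : ℕ) (x : ℝ × ℝ) (hx : ‖x‖ ≤ 1 / 2) :
    psiB m q x = x.1 ^ (m - q) * x.2 ^ q := by
  have : phiB x = 1 := phiB.one_of_mem_closedBall (by simpa [phiB] using hx)
  simp [psiB, this]

lemma psiB_bound : ∃ A : ℕ → ℕ → ℕ → ℝ, (∀ m q k, 0 ≤ A m q k) ∧
    ∀ m q k x, ‖iteratedFDeriv ℝ k (psiB m q) x‖ ≤ A m q k := by
  have h : ∀ m q k, ∃ C, ∀ x, ‖iteratedFDeriv ℝ k (psiB m q) x‖ ≤ C := fun m q k =>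
    ((psiB_compact m q).iteratedFDeriv k).exists_bound_of_continuous
      ((psiB_contDiff m q).continuous_iteratedFDeriv (by exact_mod_cast le_top))
  choose A hA using h
  exact ⟨A, fun m q k => (norm_nonneg _).trans (hA m q k 0), hA⟩

noncomputable def FB (d : ℕ → ℝ) (i : ℕ) (x : ℝ × ℝ) : ℝ :=
  ∑ q ∈ Finset.range (i + 1), d q * psiB i q x

lemma FB_contDiff (d : ℕ → ℝ) (i : ℕ) : ContDiff ℝ (⊤ : ℕ∞) (FB d i) := by
  unfold FB
  exact ContDiff.sum fun q _ => contDiff_const.mul (psiB_contDiff i q)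

lemma FB_bound (A : ℕ → ℕ → ℕ → ℝ)
    (hA : ∀ m q k x, ‖iteratedFDeriv ℝ k (psiB m q) x‖ ≤ A m q k) (d : ℕ → ℝ) (i k : ℕ)
    (x : ℝ × ℝ) :
    ‖iteratedFDeriv ℝ k (FB d i) x‖ ≤ ∑ q ∈ Finset.range (i + 1), |d q| * A i q k := by
  have hk : ((k : ℕ) : WithTop ℕ∞) ≤ ((⊤ : ℕ∞) : WithTop ℕ∞) := by exact_mod_cast le_top
  have h1 : FB d i = ∑ q ∈ Finset.range (i + 1), (d q) • (psiB i q) := by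
    ext y; simp [FB]
  rw [h1, iteratedFDeriv_sum_apply (f := fun q => (d q) • (psiB i q))
    (fun q _ => (((psiB_contDiff i q).of_le hk).const_smul (d q)).contDiffAt)]
  refine (norm_sum_le _ _).trans (Finset.sum_le_sum fun q _ => ?_)
  rw [iteratedFDeriv_const_smul_apply ((psiB_contDiff i q).of_le hk).contDiffAt, norm_smul,
    Real.norm_eq_abs]
  exact mul_le_mul_of_nonneg_left (hA _ _ _ _) (abs_nonneg _)

/-- Rescaled homogeneous term. -/
noncomputable def TB (d : ℕ → ℝ) (i : ℕ) (e : ℝ) (x : ℝ × ℝ) : ℝ := e ^ i * FB d i (e⁻¹ • x)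

lemma TB_contDiff (d : ℕ → ℝ) (i : ℕ) (e : ℝ) : ContDiff ℝ (⊤ : ℕ∞) (TB d i e) := by
  unfold TB
  exact contDiff_const.mul ((FB_contDiff d i).comp (contDiff_const_smul _))

lemma TB_zero (d : ℕ → ℝ) (i : ℕ) (e : ℝ) (he : 0 < e) (he1 : e ≤ 1) (x : ℝ × ℝ)
    (hx : 1 ≤ ‖x‖) : TB d i e x = 0 := by
  have h : 1 ≤ ‖e⁻¹ • x‖ := by
    rw [norm_smul, Real.norm_of_nonneg (by positivity)]
    have : 1 ≤ e⁻¹ := (one_le_inv₀ he).2 he1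
    nlinarith
  simp [TB, FB, psiB_zero _ _ _ h]

lemma TB_near (d : ℕ → ℝ) (i : ℕ) (e : ℝ) (he : 0 < e) :
    TB d i e =ᶠ[nhds 0] ∑ q ∈ Finset.range (i + 1), (d q) • fun x : ℝ × ℝ => x.1 ^ (i - q) * x.2 ^ q := by
  filter_upwards [Metric.closedBall_mem_nhds (0 : ℝ × ℝ) (show 0 < e / 2 by positivity)] with x hx
  have hx' : ‖x‖ ≤ e / 2 := by simpa using hx
  have h : ‖e⁻¹ • x‖ ≤ 1 / 2 := by
    rw [norm_smul, Real.norm_of_nonneg (by positivity), inv_mul_le_iff₀ he]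
    linarith
  simp only [TB, FB, Finset.sum_apply, Pi.smul_apply, smul_eq_mul, Finset.mul_sum]
  refine Finset.sum_congr rfl fun q hq => ?_
  rw [psiB_one _ _ _ h]
  have hq' : q ≤ i := by simpa [Nat.lt_succ_iff] using hq
  have : e ^ i = e ^ (i - q) * e ^ q := by rw [← pow_add]; congr 1; omega
  rw [this]
  simp only [Prod.smul_fst, Prod.smul_snd, smul_eq_mul, mul_pow, inv_pow]
  field_simp

lemma TB_mixed (d : ℕ → ℝ) (i : ℕ) (e : ℝ) (he : 0 < e) (p r : ℕ) :
    mixedD p r (TB d i e) 0 =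
      if p + r = i then d r * ((p.factorial : ℝ) * (r.factorial : ℝ)) else 0 := by
  obtain ⟨v, -, H⟩ := mixedD_eq p r
  have hm : ∀ q, ContDiff ℝ (⊤ : ℕ∞) (fun x : ℝ × ℝ => x.1 ^ (i - q) * x.2 ^ q) := by
    intro q; fun_prop
  have hk : (((p + r : ℕ) : ℕ∞) : WithTop ℕ∞) ≤ ((⊤ : ℕ∞) : WithTop ℕ∞) := by exact_mod_cast le_top
  rw [H _ (TB_contDiff d i e), ((TB_near d i e he).iteratedFDeriv ℝ (p + r)).eq_of_nhds,
    iteratedFDeriv_sum_apply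
    (f := fun q => (d q) • fun x : ℝ × ℝ => x.1 ^ (i - q) * x.2 ^ q)
    (fun q _ => (((hm q).of_le hk).const_smul (d q)).contDiffAt)]
  rw [sum_apply]
  have h1 : ∀ q, (iteratedFDeriv ℝ (p + r) ((d q) • fun x : ℝ × ℝ => x.1 ^ (i - q) * x.2 ^ q) 0) v
      = d q * ((if p = i - q then ((i - q).factorial : ℝ) else 0) *
        (if r = q then (q.factorial : ℝ) else 0)) := by
    intro q
    rw [iteratedFDeriv_const_smul_apply ((hm q).of_le hk).contDiffAt, smul_apply,
      ← H _ (hm q), mixedD_monomial, smul_eq_mul]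
  simp only [h1]
  split_ifs with h
  · rw [Finset.sum_eq_single r]
    · subst h; simp
    · intro b _ hb; simp [Ne.symm hb]
    · intro hr; simp at hr; omega
  · refine Finset.sum_eq_zero fun q hq => ?_
    have : q ≤ i := by simpa [Nat.lt_succ_iff] using hq
    by_cases h2 : r = q
    · have : p ≠ i - q := by omega
      simp [this]
    · simp [h2]

theorem stmt_15 :
    ∃ s : ℕ → ℝ, ∀ (D : ℝ), 1 ≤ D → ∀ K : ℕ → ℝ, Monotone K →
      ∀ c : ℕ → ℕ → ℝ,
      (∀ m q : ℕ, q ≤ m → |c m q| ≤ D ^ m * K m * (m.choose q : ℝ)) →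
      ∀ M : ℕ, ∃ h : ℝ × ℝ → ℝ, ContDiff ℝ (⊤ : ℕ∞) h ∧ HasCompactSupport h ∧
        (∀ m q : ℕ, q ≤ m →
          iteratedDeriv (m - q) (fun a => iteratedDeriv q (fun b => h (a, b)) 0) 0 *
            (m.choose q : ℝ) = c m q) ∧
        (∀ p q : ℕ, p + q ≤ M → ∀ x : ℝ × ℝ,
          |iteratedDeriv p (fun a => iteratedDeriv q (fun b => h (a, b)) x.2) x.1| ≤
            s M * D ^ M * K M + Real.exp D / ((Nat.floor D).factorial : ℝ)) := by
  obtain ⟨A, hA0, hA⟩ := psiB_bound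
  refine ⟨fun M => ∑ k ∈ Finset.range (M + 1), ∑ i ∈ Finset.range (M + 1),
    ∑ q ∈ Finset.range (i + 1), A i q k, ?_⟩
  intro D hD K hK c hc M
  have hKpos : ∀ m, 0 ≤ K m := by
    intro m
    have h := (abs_nonneg _).trans (hc m 0 (Nat.zero_le _))
    simp only [Nat.choose_zero_right, Nat.cast_one, mul_one] at h
    exact nonneg_of_mul_nonneg_right h (by positivity)
  set η : ℝ := Real.exp D / ((Nat.floor D).factorial : ℝ) with hη
  have hηpos : 0 < η := by positivity
  set d : ℕ → ℕ → ℝ := fun m q =>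
    c m q / ((m.choose q : ℝ) * (((m - q).factorial : ℝ) * (q.factorial : ℝ))) with hd
  have hdb : ∀ m q, q ≤ m → |d m q| ≤ D ^ m * K m := by
    intro m q hq
    have hch : (0 : ℝ) < (m.choose q : ℝ) := by exact_mod_cast Nat.choose_pos hq
    have h1 : (1 : ℝ) ≤ ((m - q).factorial : ℝ) * (q.factorial : ℝ) := by
      exact_mod_cast Nat.mul_pos (Nat.factorial_pos _) (Nat.factorial_pos _)
    have hKm := hKpos m
    rw [hd, abs_div, abs_of_pos (a := (m.choose q : ℝ) * _) (by positivity),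
      div_le_iff₀ (by positivity)]
    refine (hc m q hq).trans ?_
    rw [← mul_assoc]
    exact le_mul_of_one_le_right (by positivity) h1
  set C : ℕ → ℕ → ℝ := fun i k => ∑ q ∈ Finset.range (i + 1), |d i q| * A i q k with hC
  have hC0 : ∀ i k, 0 ≤ C i k := fun i k =>
    Finset.sum_nonneg fun q _ => mul_nonneg (abs_nonneg _) (hA0 _ _ _)
  set B : ℕ → ℝ := fun i => 1 + ∑ k ∈ Finset.range i, C i k with hB
  have hBpos : ∀ i, 0 < B i := fun i =>
    add_pos_of_pos_of_nonneg one_pos (Finset.sum_nonneg fun k _ => hC0 i k)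
  have hCB : ∀ i k, k < i → C i k ≤ B i := by
    intro i k hk
    have := Finset.single_le_sum (f := fun k => C i k) (fun k _ => hC0 i k)
      (Finset.mem_range.2 hk)
    simp only [hB]
    linarith
  set ε : ℕ → ℝ := fun i => if i ≤ M then 1 else min 1 (η / 2 * (1 / 2) ^ i / B i) with hε
  have hεpos : ∀ i, 0 < ε i := by
    intro i
    have := hBpos i
    simp only [hε]
    split_ifs
    · exact one_pos
    · exact lt_min one_pos (by positivity)
  have hε1 : ∀ i, ε i ≤ 1 := by
    intro i
    simp only [hε]
    split_ifs
    · exact le_rfl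
    · exact min_le_left _ _
  set T : ℕ → ℝ × ℝ → ℝ := fun i => TB (d i) i (ε i) with hT
  have hTs : ∀ i, ContDiff ℝ (⊤ : ℕ∞) (T i) := fun i => TB_contDiff _ _ _
  have hTb : ∀ k i x, ‖iteratedFDeriv ℝ k (T i) x‖ ≤ (ε i) ^ i * ((ε i)⁻¹) ^ k * C i k :=
    fun k i x => scale_bound _ (FB_contDiff _ _) k i _ _ (hεpos i) (FB_bound A hA _ _ _) x
  have htail : ∀ k i, M < i → k < i → (ε i) ^ i * ((ε i)⁻¹) ^ k * C i k ≤ η / 2 * (1 / 2) ^ i := by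
    intro k i hi hk
    have he := hεpos i
    have h1 : (ε i) ^ i * ((ε i)⁻¹) ^ k = (ε i) ^ (i - k) := by
      rw [inv_pow, ← div_eq_mul_inv, pow_sub₀ _ he.ne' hk.le, div_eq_mul_inv]
    have h2 : (ε i) ^ (i - k) ≤ ε i :=
      pow_le_of_le_one he.le (hε1 i) (by omega)
    have h3 : ε i ≤ η / 2 * (1 / 2) ^ i / B i := by
      simp only [hε, if_neg (not_le.2 hi)]
      exact min_le_right _ _
    rw [h1]
    calc (ε i) ^ (i - k) * C i k ≤ ε i * B i :=
          mul_le_mul h2 (hCB i k hk) (hC0 i k) he.le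
      _ ≤ _ := (le_div_iff₀ (hBpos i)).1 h3
  set v : ℕ → ℕ → ℝ := fun k i =>
    if M < i ∧ k < i then η / 2 * (1 / 2) ^ i else (ε i) ^ i * ((ε i)⁻¹) ^ k * C i k with hv
  have hTv : ∀ k i x, ‖iteratedFDeriv ℝ k (T i) x‖ ≤ v k i := by
    intro k i x
    simp only [hv]
    split_ifs with h
    · exact (hTb k i x).trans (htail k i h.1 h.2)
    · exact hTb k i x
  have hgeo : HasSum (fun i : ℕ => η / 2 * (1 / 2 : ℝ) ^ i) η := by
    have := hasSum_geometric_two.mul_left (η / 2)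
    rwa [div_mul_cancel₀ _ two_ne_zero] at this
  have hvs : ∀ k, Summable (v k) := by
    intro k
    refine hgeo.summable.congr_atTop ?_
    filter_upwards [Filter.eventually_gt_atTop M, Filter.eventually_gt_atTop k] with i h1 h2
    simp only [hv, if_pos (And.intro h1 h2)]
  have hsm : ContDiff ℝ (⊤ : ℕ∞) (fun x => ∑' i, T i x) :=
    contDiff_tsum hTs (fun k _ => hvs k) (fun k i x _ => hTv k i x)
  have hit : ∀ k x, iteratedFDeriv ℝ k (fun y => ∑' i, T i y) x = ∑' i, iteratedFDeriv ℝ k (T i) x :=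
    fun k x => iteratedFDeriv_tsum_apply hTs (fun k _ => hvs k) (fun k i x _ => hTv k i x)
      le_top x
  refine ⟨fun x => ∑' i, T i x, hsm, ?_, ?_, ?_⟩
  · refine HasCompactSupport.intro (isCompact_closedBall (0 : ℝ × ℝ) 1) fun x hx => ?_
    have hx' : 1 ≤ ‖x‖ := by
      have : 1 < ‖x‖ := by simpa using hx
      exact this.le
    have : ∀ i, T i x = 0 := fun i => TB_zero _ _ _ (hεpos i) (hε1 i) x hx'
    simp [this]
  · intro m q hq
    change mixedD (m - q) q (fun x => ∑' i, T i x) 0 * _ = _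
    obtain ⟨w, -, H⟩ := mixedD_eq (m - q) q
    have hsum : Summable fun i => iteratedFDeriv ℝ (m - q + q) (T i) 0 :=
      Summable.of_norm_bounded (hvs _) (fun i => hTv _ i 0)
    have h1 := ContinuousMultilinearMap.hasSum_eval hsum.hasSum w
    rw [H _ hsm, hit, ← h1.tsum_eq]
    have h2 : ∀ i, iteratedFDeriv ℝ (m - q + q) (T i) 0 w = if i = m then
        d m q * (((m - q).factorial : ℝ) * (q.factorial : ℝ)) else 0 := by
      intro i
      rw [← H _ (hTs i), TB_mixed _ _ _ (hεpos i)]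
      by_cases him : i = m
      · subst him
        rw [if_pos (by omega), if_pos rfl]
      · rw [if_neg (by omega), if_neg him]
    simp only [h2, tsum_ite_eq]
    have hch : (m.choose q : ℝ) ≠ 0 := by exact_mod_cast (Nat.choose_pos hq).ne'
    simp only [hd]
    field_simp
  · intro p q hpq x
    change |mixedD p q (fun x => ∑' i, T i x) x| ≤ _
    obtain ⟨w, hw, H⟩ := mixedD_eq p q
    rw [H _ hsm, ← Real.norm_eq_abs]
    have h1 : ‖iteratedFDeriv ℝ (p + q) (fun x => ∑' i, T i x) x w‖ ≤
        ‖iteratedFDeriv ℝ (p + q) (fun x => ∑' i, T i x) x‖ := by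
      refine (ContinuousMultilinearMap.le_opNorm _ _).trans ?_
      refine mul_le_of_le_one_right (norm_nonneg _) ?_
      exact Finset.prod_le_one (fun _ _ => norm_nonneg _) (fun i _ => hw i)
    refine h1.trans ?_
    rw [hit]
    have hfin : HasSum (fun i => if i ∈ Finset.range (M + 1) then C i (p + q) else 0)
        (∑ i ∈ Finset.range (M + 1), C i (p + q)) := by
      have := hasSum_sum_of_ne_finset_zero
        (f := fun i => if i ∈ Finset.range (M + 1) then C i (p + q) else 0)
        (L := SummationFilter.unconditional ℕ) (s := Finset.range (M + 1)) (fun b hb => if_neg hb)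
      rwa [Finset.sum_congr rfl (fun i hi => if_pos hi)] at this
    refine (tsum_of_norm_bounded (hfin.add hgeo) (fun i => ?_)).trans ?_
    · by_cases hi : i ≤ M
      · have : ε i = 1 := by simp [hε, hi]
        have h2 := hTb (p + q) i x
        rw [this] at h2
        simp only [one_pow, inv_one, one_mul] at h2
        rw [if_pos (by simp; omega)]
        have : 0 ≤ η / 2 * (1 / 2 : ℝ) ^ i := by positivity
        linarith
      · rw [if_neg (by simp; omega), zero_add]
        exact (hTb _ i x).trans (htail _ i (by omega) (by omega))
    · refine add_le_add_left ?_ η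
      have hM0 : 0 ≤ D ^ M * K M := mul_nonneg (by positivity) (hKpos M)
      have h3 : ∀ i ∈ Finset.range (M + 1), C i (p + q) ≤
          (∑ r ∈ Finset.range (i + 1), A i r (p + q)) * (D ^ M * K M) := by
        intro i hi
        have hi' : i ≤ M := by simpa [Nat.lt_succ_iff] using hi
        simp only [hC, Finset.sum_mul]
        refine Finset.sum_le_sum fun r hr => ?_
        have hr' : r ≤ i := by simpa [Nat.lt_succ_iff] using hr
        rw [mul_comm]
        refine mul_le_mul_of_nonneg_left ((hdb i r hr').trans ?_) (hA0 _ _ _)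
        exact mul_le_mul (pow_le_pow_right₀ hD hi') (hK hi') (hKpos i) (by positivity)
      refine (Finset.sum_le_sum h3).trans ?_
      rw [← Finset.sum_mul, mul_assoc]
      refine mul_le_mul_of_nonneg_right ?_ hM0
      exact Finset.single_le_sum
        (f := fun k => ∑ i ∈ Finset.range (M + 1), ∑ q ∈ Finset.range (i + 1), A i q k)
        (fun k _ => Finset.sum_nonneg fun i _ => Finset.sum_nonneg fun q _ => hA0 _ _ _)
        (Finset.mem_range.2 (by omega))
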